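/- Let f : Λ → ℂ be discrete analytic on Λ, not identically zero, and suppose δ_x f = λ·f for some λ ∈ ℂ. Then λ ∉ {−1, −2α₊, −2α₋} (in particular 1+λ ≠ 0 and 1+α₋λ ≠ 0), f(0) ≠ 0, and f(z) = f(0)·e_λ(z) for all z ∈ Λ. Consequently every eigenspace of δ_x on the space of discrete analytic functions on Λ is one-dimensional. -/

import Mathlib

open Complex

noncomputable section

/-- The Gaussian integer lattice Λ = ℤ + iℤ. -/
abbrev GI := GaussianInt

/-- The lattice element i. -/
def Ii : GI := ⟨0, 1⟩

/-- The difference operator δ_x. -/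
def dx (f : GI → ℂ) : GI → ℂ := fun z => f (z + 1) - f z

/-- The difference operator δ_y. -/
def dy (f : GI → ℂ) : GI → ℂ := fun z => f (z + Ii) - f z

/-- Discrete analyticity on the full lattice Λ. -/
def DA (f : GI → ℂ) : Prop :=
  ∀ z : GI, (f (z + 1 + Ii) - f z) / (1 + I) = (f (z + 1) - f (z + Ii)) / (1 - I)

/-- α₊ = (1+i)/2. -/
def ap : ℂ := (1 + I) / 2

/-- α₋ = (1−i)/2. -/
def am : ℂ := (1 - I) / 2

/-- e_λ(z) = (1+λ)^{Re z} · ((1+α₊λ)/(1+α₋λ))^{Im z}, with integer exponents. -/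
def eFun (lam : ℂ) (z : GI) : ℂ :=
  (1 + lam) ^ z.re * ((1 + ap * lam) / (1 + am * lam)) ^ z.im

theorem aux_step (f : GI → ℂ) (lam : ℂ) (hf : DA f)
    (heig : ∀ z : GI, dx f z = lam * f z) :
    (∀ z, f (z + 1) = (1 + lam) * f z) ∧
    (∀ z, (1 + am * lam) * f (z + Ii) = (1 + ap * lam) * f z) := by
  have h1 : ∀ z, f (z + 1) = (1 + lam) * f z := by
    intro z
    have := heig z
    unfold dx at this
    linear_combination this
  refine ⟨h1, fun z => ?_⟩
  have h := hf z
  have e : z + 1 + Ii = (z + Ii) + 1 := by ring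
  have n1 : (1 + I : ℂ) ≠ 0 := by
    intro h; simpa using congrArg Complex.re h
  have n2 : (1 - I : ℂ) ≠ 0 := by
    intro h; simpa using congrArg Complex.re h
  rw [e, h1, h1, div_eq_div_iff n1 n2] at h
  unfold am ap
  linear_combination h / 2

theorem aux_ne (f : GI → ℂ) (lam : ℂ) (hf : DA f) (hf0 : f ≠ 0)
    (heig : ∀ z : GI, dx f z = lam * f z) :
    1 + lam ≠ 0 ∧ 1 + am * lam ≠ 0 ∧ 1 + ap * lam ≠ 0 := by
  obtain ⟨h1, h2⟩ := aux_step f lam hf heig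
  have n1 : (1 + I : ℂ) ≠ 0 := by
    intro h; simpa using congrArg Complex.re h
  have n2 : (1 - I : ℂ) ≠ 0 := by
    intro h; simpa using congrArg Complex.re h
  have key : ¬ (1 + am * lam = 0 ∧ 1 + ap * lam = 0) := by
    rintro ⟨ha, hb⟩
    unfold am at ha
    unfold ap at hb
    have h0 : I * lam = 0 := by linear_combination hb - ha
    have hl : lam = 0 := (mul_eq_zero.mp h0).resolve_left I_ne_zero
    rw [hl] at ha
    simp at ha
  refine ⟨fun h => hf0 ?_, fun h => hf0 ?_, fun h => hf0 ?_⟩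
  · funext z
    have := h1 (z - 1)
    rw [h, sub_add_cancel, zero_mul] at this
    exact this
  · funext z
    have := h2 z
    rw [h, zero_mul] at this
    exact (mul_eq_zero.mp this.symm).resolve_left (fun hb => key ⟨h, hb⟩)
  · funext z
    have := h2 (z - Ii)
    rw [h, sub_add_cancel, zero_mul] at this
    exact (mul_eq_zero.mp this).resolve_left (fun ha => key ⟨ha, h⟩)

theorem aux_geom (u : ℤ → ℂ) (q : ℂ) (hq : q ≠ 0) (h : ∀ n, u (n + 1) = q * u n) (n : ℤ) :
    u n = u 0 * q ^ n := by
  induction n using Int.induction_on with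
  | zero => simp
  | succ k ih => rw [h, ih, zpow_add_one₀ hq]; ring
  | pred k ih =>
    have := h (-(k : ℤ) - 1)
    rw [sub_add_cancel, ih] at this
    rw [zpow_sub_one₀ hq]
    field_simp
    linear_combination -this

theorem aux_form (f : GI → ℂ) (lam : ℂ) (hf : DA f)
    (heig : ∀ z : GI, dx f z = lam * f z)
    (hn : 1 + lam ≠ 0 ∧ 1 + am * lam ≠ 0 ∧ 1 + ap * lam ≠ 0) (z : GI) :
    f z = f 0 * eFun lam z := by
  obtain ⟨h1, h2⟩ := aux_step f lam hf heig
  obtain ⟨a, b, c⟩ := hn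
  obtain ⟨x, y⟩ := z
  have A := aux_geom (fun n => f ⟨n, y⟩) (1 + lam) a (fun n => by
    have := h1 ⟨n, y⟩
    have e : (⟨n, y⟩ : GI) + 1 = ⟨n + 1, y⟩ := by ext <;> simp
    rwa [e] at this) x
  have B := aux_geom (fun n => f ⟨0, n⟩) ((1 + ap * lam) / (1 + am * lam)) (div_ne_zero c b)
    (fun n => by
    have := h2 ⟨0, n⟩
    have e : (⟨0, n⟩ : GI) + Ii = ⟨0, n + 1⟩ := by ext <;> simp [Ii]
    rw [e] at this
    rw [div_mul_eq_mul_div, eq_div_iff b]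
    linear_combination this) y
  rw [A, B]
  have e : (⟨0, 0⟩ : GI) = 0 := rfl
  rw [e]
  unfold eFun
  ring

/-- if `f` is discrete analytic on Λ, not identically zero, and is an
eigenfunction of δ_x with eigenvalue λ, then λ ∉ {−1, −2α₊, −2α₋}
(in particular 1+λ ≠ 0 and 1+α₋λ ≠ 0), f(0) ≠ 0, and f = f(0)·e_λ.
Consequently every eigenspace of δ_x on the discrete analytic functions on Λ is
one-dimensional. -/
theorem stmt2 (f : GI → ℂ) (lam : ℂ) (hf : DA f) (hf0 : f ≠ 0)
    (heig : ∀ z : GI, dx f z = lam * f z) :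
    (lam ≠ -1 ∧ lam ≠ -2 * ap ∧ lam ≠ -2 * am) ∧
    (1 + lam ≠ 0 ∧ 1 + am * lam ≠ 0) ∧
    f 0 ≠ 0 ∧
    (∀ z : GI, f z = f 0 * eFun lam z) ∧
    (∀ (mu : ℂ) (g h : GI → ℂ), DA g → DA h → g ≠ 0 →
      (∀ z : GI, dx g z = mu * g z) → (∀ z : GI, dx h z = mu * h z) →
      ∃ c : ℂ, ∀ z : GI, h z = c * g z) := by
  have nz : ∀ (mu : ℂ) (g : GI → ℂ), DA g → g ≠ 0 → (∀ z : GI, dx g z = mu * g z) →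
      g 0 ≠ 0 := by
    intro mu g hg hg0 he h0
    apply hg0
    funext z
    rw [aux_form g mu hg he (aux_ne g mu hg hg0 he) z, h0, zero_mul]
    rfl
  have hn := aux_ne f lam hf hf0 heig
  have hpm : ap * am = 1 / 2 := by
    unfold ap am
    linear_combination -I_mul_I / 4
  refine ⟨⟨?_, ?_, ?_⟩, ⟨hn.1, hn.2.1⟩, nz lam f hf hf0 heig, aux_form f lam hf heig hn, ?_⟩
  · intro h
    exact hn.1 (by rw [h]; ring)
  · intro h
    exact hn.2.1 (by rw [h]; linear_combination -2 * hpm)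
  · intro h
    exact hn.2.2 (by rw [h]; linear_combination -2 * hpm)
  · intro mu g h hg hh hg0 heg heh
    have hm := aux_ne g mu hg hg0 heg
    have g0 := nz mu g hg hg0 heg
    refine ⟨h 0 / g 0, fun z => ?_⟩
    rw [aux_form g mu hg heg hm z, aux_form h mu hh heh hm z]
    field_simp
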